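/- For every square-free integer s > 7 coprime to 7, the ring of integers of K = Q(√7, √s) has Pythagoras number at least 6. -/

import Mathlib

open scoped Classical

noncomputable section

/-- `α` is a sum of `n` squares of elements of `S ⊆ ℝ`. -/
def SumOfSquaresLen (S : Set ℝ) (n : ℕ) (α : ℝ) : Prop :=
  ∃ x : Fin n → ℝ, (∀ i, x i ∈ S) ∧ α = ∑ i, x i ^ 2

/-- The length of `α` as a sum of squares of elements of `S` (∞ if not a sum of squares). -/
def sqLength (S : Set ℝ) (α : ℝ) : ℕ∞ :=
  sInf {n : ℕ∞ | ∃ k : ℕ, n = (k : ℕ∞) ∧ SumOfSquaresLen S k α}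

/-- The Pythagoras number of `S ⊆ ℝ`. -/
def pythagorasNumber (S : Set ℝ) : ℕ∞ :=
  sSup {n : ℕ∞ | ∃ α : ℝ, (∃ k : ℕ, SumOfSquaresLen S k α) ∧ n = sqLength S α}

/-- The biquadratic field `ℚ(√p, √q)` as a subfield of `ℝ`. -/
def biquadField (p q : ℝ) : IntermediateField ℚ ℝ :=
  IntermediateField.adjoin ℚ {Real.sqrt p, Real.sqrt q}

/-- The ring of integers of `ℚ(√p, √q)`, viewed as a subset of `ℝ`. -/
def ringOfInt (p q : ℝ) : Set ℝ :=
  {x : ℝ | x ∈ biquadField p q ∧ IsIntegral ℤ x}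

lemma int_congr {x y : ℝ} (h : IsIntegral ℤ x) (e : y = x) : IsIntegral ℤ y := e ▸ h

lemma rat_int_of_integral (q : ℚ) (h : IsIntegral ℤ (q : ℝ)) : ∃ n : ℤ, q = n := by
  have h' : IsIntegral ℤ q := by
    have : IsIntegral ℤ (algebraMap ℚ ℝ q) := by simpa using h
    exact (isIntegral_algebraMap_iff (algebraMap ℚ ℝ).injective).1 this
  obtain ⟨n, hn⟩ := IsIntegrallyClosed.isIntegral_iff.1 h'
  exact ⟨n, by simpa using hn.symm⟩

lemma int_of_mul_sq (D : ℕ) (hD : Squarefree D) (v : ℚ) (j : ℤ) (h : (D:ℚ)*v^2 = j) : ∃ n : ℤ, v = n := by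
  have hD0 : (D:ℚ) ≠ 0 := by exact_mod_cast hD.ne_zero
  have h1 : ((D:ℚ)*v)^2 = ((D*j : ℤ) : ℚ) := by push_cast; rw [← h]; ring
  have h2 : IsIntegral ℤ ((D:ℚ)*v) := by
    apply IsIntegral.of_pow (n := 2) (by norm_num)
    rw [h1]; exact isIntegral_algebraMap (R := ℤ) (A := ℚ) (x := (D*j:ℤ))
  obtain ⟨t, ht⟩ := IsIntegrallyClosed.isIntegral_iff.1 h2
  have ht : (t:ℚ) = D*v := by simpa using ht
  have h3 : t^2 = D*j := by
    have : ((t^2 : ℤ):ℚ) = ((D*j : ℤ):ℚ) := by rw [← h1, ← ht]; push_cast; ring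
    exact_mod_cast this
  have h4 : (D:ℤ) ∣ t := by
    have : Squarefree (D:ℤ) := Int.squarefree_natCast.2 hD
    exact (this.dvd_pow_iff_dvd (two_ne_zero)).1 ⟨j, h3⟩
  obtain ⟨n, rfl⟩ := h4
  refine ⟨n, ?_⟩
  push_cast at ht
  exact (mul_left_cancel₀ hD0 ht).symm

lemma quad_int (D : ℕ) (hD : Squarefree D) (u v : ℚ)
    (h1 : IsIntegral ℤ ((u:ℝ)+v*√D)) (h2 : IsIntegral ℤ ((u:ℝ)-v*√D)) :
    ∃ m n k : ℤ, 2*u = m ∧ 2*v = n ∧ m^2-D*n^2 = 4*k := by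
  obtain ⟨m, hm⟩ := rat_int_of_integral (2*u) (by
    exact int_congr (h1.add h2) (by push_cast; ring))
  obtain ⟨k, hk⟩ := rat_int_of_integral (u^2-D*v^2) (by
    refine int_congr (h1.mul h2) ?_
    push_cast
    have : (√(D:ℝ))^2 = D := Real.sq_sqrt (by positivity)
    linear_combination ((v:ℝ)^2) * this)
  obtain ⟨n, hn⟩ := int_of_mul_sq D hD (2*v) (m^2-4*k) (by
    push_cast; rw [← hm, ← hk]; ring)
  refine ⟨m, n, k, hm, hn, ?_⟩
  have : ((m^2-D*n^2 : ℤ) : ℚ) = ((4*k : ℤ) : ℚ) := by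
    push_cast; rw [← hm, ← hn, ← hk]; ring
  exact_mod_cast this

lemma sqf_not_sq (D : ℕ) (hD : Squarefree D) (h1 : 1 < D) (a b : ℚ) (h : a^2 = D*b^2) : a = 0 ∧ b = 0 := by
  by_cases hb : b = 0
  · subst hb; simp at h; exact ⟨h, rfl⟩
  · exfalso
    have h2 : (a/b)^2 = D := by field_simp; linarith
    have h3 : (D:ℚ) * ((b/a))^2 = (1:ℤ) := by
      have ha : a ≠ 0 := by
        rintro rfl
        have : (D:ℚ) ≠ 0 := by exact_mod_cast hD.ne_zero
        have hb2 : b^2 ≠ 0 := pow_ne_zero _ hb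
        have : (D:ℚ)*b^2 ≠ 0 := mul_ne_zero this hb2
        apply this; rw [← h]; ring
      field_simp; push_cast; linarith
    obtain ⟨n, hn⟩ := int_of_mul_sq D hD _ _ h3
    rw [hn] at h3
    have h4 : (D:ℤ)*n^2 = 1 := by exact_mod_cast h3
    have := Int.eq_one_or_neg_one_of_mul_eq_one h4
    omega

/-- linear independence of 1, √7, √s, √7√s -/
lemma lin_indep (s : ℕ) (hsf : Squarefree s) (hs7 : 7 < s) (h7s : Squarefree (7*s))
    (a b c d : ℚ) (h : (a:ℝ)+b*√7+c*√s+d*(√7*√s) = 0) : a = 0 ∧ b = 0 ∧ c = 0 ∧ d = 0 := by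
  have r7 : (√(7:ℝ))^2 = 7 := Real.sq_sqrt (by positivity)
  have rs : (√(s:ℝ))^2 = s := Real.sq_sqrt (by positivity)
  have sq7 : Squarefree 7 := (by norm_num : Nat.Prime 7).squarefree
  have li7 : ∀ x y : ℚ, (x:ℝ)+y*√7 = 0 → x = 0 ∧ y = 0 := by
    intro x y hxy
    apply sqf_not_sq 7 sq7 (by norm_num)
    have : (x:ℝ)^2 = 7*(y:ℝ)^2 := by
      have : (x:ℝ) = -(y*√7) := by linarith
      rw [this]; linear_combination (y:ℝ)^2*r7
    exact_mod_cast this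
  have e : ((a^2+7*b^2-s*(c^2+7*d^2) : ℚ):ℝ) + ((2*a*b-2*s*c*d : ℚ):ℝ)*√7 = 0 := by
    push_cast
    have : ((a:ℝ)+b*√7+c*√s+d*(√7*√s)) * ((a:ℝ)+b*√7-c*√s-d*(√7*√s)) = 0 := by rw [h]; ring
    linear_combination this + (-(b:ℝ)^2+s*(d:ℝ)^2)*r7 + ((c:ℝ)+d*√7)^2*rs
  obtain ⟨e1, e2⟩ := li7 _ _ e
  have e3 : (a^2-s*c^2)*(a^2-7*s*d^2) = 0 := by
    have : a*b = s*c*d := by linarith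
    have e4 : 7*b^2 = s*c^2+7*s*d^2-a^2 := by linarith
    have e5 : a^2*(7*b^2) = 7*(s*c*d)^2 := by rw [← this]; ring
    rw [e4] at e5
    linear_combination -e5
  rcases mul_eq_zero.1 e3 with e3 | e3
  · obtain ⟨rfl, rfl⟩ := sqf_not_sq s hsf (by omega) a c (by linarith)
    obtain ⟨rfl, rfl⟩ := sqf_not_sq s hsf (by omega) b d (by linarith)
    simp
  · obtain ⟨rfl, rfl⟩ := sqf_not_sq (7*s) h7s (by omega) a d (by push_cast; linarith)
    obtain ⟨h1, rfl⟩ := sqf_not_sq (7*s) h7s (by omega) (7*b) c (by push_cast; linear_combination 7*e1)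
    simp at h1
    simp [h1]

lemma mem_form (s : ℕ) (x : ℝ) (hx : x ∈ IntermediateField.adjoin ℚ {√(7:ℝ), √(s:ℝ)}) :
    ∃ a b c d : ℚ, x = (a:ℝ)+b*√7+c*√s+d*(√7*√s) := by
  have r7 : (√(7:ℝ))^2 = 7 := Real.sq_sqrt (by positivity)
  have rs : (√(s:ℝ))^2 = s := Real.sq_sqrt (by positivity)
  have halg : ∀ y ∈ ({√(7:ℝ), √(s:ℝ)} : Set ℝ), IsAlgebraic ℚ y := by
    intro y hy
    have : ∃ n : ℕ, y^2 = n := by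
      rcases hy with rfl | rfl
      · exact ⟨7, by rw [r7]; norm_num⟩
      · exact ⟨s, rs⟩
    obtain ⟨n, hn⟩ := this
    apply IsIntegral.isAlgebraic
    apply IsIntegral.of_pow (n := 2) (by norm_num)
    rw [hn]; simpa using isIntegral_algebraMap (R := ℚ) (A := ℝ) (x := (n:ℚ))
  have hx' : x ∈ (IntermediateField.adjoin ℚ {√(7:ℝ), √(s:ℝ)}).toSubalgebra := hx
  rw [IntermediateField.adjoin_toSubalgebra_of_isAlgebraic halg] at hx'
  clear hx
  induction hx' using Algebra.adjoin_induction with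
  | mem y hy =>
    rcases hy with rfl | rfl
    · exact ⟨0, 1, 0, 0, by simp⟩
    · exact ⟨0, 0, 1, 0, by simp⟩
  | algebraMap r => exact ⟨r, 0, 0, 0, by simp⟩
  | add y z _ _ hy hz =>
    obtain ⟨a, b, c, d, rfl⟩ := hy
    obtain ⟨a', b', c', d', rfl⟩ := hz
    exact ⟨a+a', b+b', c+c', d+d', by push_cast; ring⟩
  | mul y z _ _ hy hz =>
    obtain ⟨a, b, c, d, rfl⟩ := hy
    obtain ⟨a', b', c', d', rfl⟩ := hz
    refine ⟨a*a'+7*b*b'+s*c*c'+7*s*d*d', a*b'+b*a'+s*(c*d'+d*c'), a*c'+c*a'+7*(b*d'+d*b'),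
      a*d'+d*a'+b*c'+c*b', ?_⟩
    push_cast
    linear_combination ((b:ℝ)*b'+ (b*d'+d*b')*√s + d*d'*(√s)^2)*r7 + ((c:ℝ)*c'+(c*d'+d*c')*√7+7*d*d')*rs

lemma conj_poly (s : ℕ) (a b c d : ℚ) (p : Polynomial ℤ) :
    ∃ a' b' c' d' : ℚ, ∀ e f : ℝ, e^2 = 1 → f^2 = 1 →
      Polynomial.aeval ((a:ℝ)+b*(e*√7)+c*(f*√s)+d*((e*√7)*(f*√s))) p
        = (a':ℝ)+b'*(e*√7)+c'*(f*√s)+d'*((e*√7)*(f*√s)) := by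
  have r7 : (√(7:ℝ))^2 = 7 := Real.sq_sqrt (by positivity)
  have rs : (√(s:ℝ))^2 = s := Real.sq_sqrt (by positivity)
  induction p using Polynomial.induction_on with
  | C r => exact ⟨r, 0, 0, 0, by intro e f _ _; simp⟩
  | add p q hp hq =>
    obtain ⟨a, b, c, d, h⟩ := hp
    obtain ⟨a', b', c', d', h'⟩ := hq
    refine ⟨a+a', b+b', c+c', d+d', ?_⟩
    intro e f he hf
    rw [map_add, h e f he hf, h' e f he hf]; push_cast; ring
  | monomial n r h =>
    obtain ⟨a', b', c', d', h⟩ := h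
    refine ⟨a*a'+7*b*b'+s*c*c'+7*s*d*d', a*b'+b*a'+s*(c*d'+d*c'), a*c'+c*a'+7*(b*d'+d*b'),
      a*d'+d*a'+b*c'+c*b', ?_⟩
    intro e f he hf
    have he7 : (e*√7)^2 = 7 := by rw [mul_pow, he, r7]; ring
    have hfs : (f*√s)^2 = s := by rw [mul_pow, hf, rs]; ring
    rw [show Polynomial.C r * Polynomial.X^(n+1) = (Polynomial.C r * Polynomial.X^n) * Polynomial.X by rw [pow_succ, mul_assoc], map_mul, h e f he hf, Polynomial.aeval_X]
    generalize e*√7 = A at *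
    generalize f*√s = B at *
    push_cast
    linear_combination ((b:ℝ)*b'+ (b*d'+d*b')*B + d*d'*B^2)*he7 + ((c:ℝ)*c'+(c*d'+d*c')*A+7*d*d')*hfs

lemma conj_int (s : ℕ) (hsf : Squarefree s) (hs7 : 7 < s) (h7s : Squarefree (7*s)) (a b c d : ℚ)
    (h : IsIntegral ℤ ((a:ℝ)+b*√7+c*√s+d*(√7*√s))) (e f : ℝ) (he : e^2 = 1) (hf : f^2 = 1) :
    IsIntegral ℤ ((a:ℝ)+b*(e*√7)+c*(f*√s)+d*((e*√7)*(f*√s))) := by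
  obtain ⟨p, hp, hp0⟩ := h
  obtain ⟨a', b', c', d', hh⟩ := conj_poly s a b c d p
  have h1 := hh 1 1 (by norm_num) (by norm_num)
  rw [← Polynomial.aeval_def] at hp0
  simp only [one_mul] at h1
  rw [hp0] at h1
  obtain ⟨rfl, rfl, rfl, rfl⟩ := lin_indep s hsf hs7 h7s a' b' c' d' h1.symm
  refine ⟨p, hp, ?_⟩
  rw [← Polynomial.aeval_def, hh e f he hf]
  simp

lemma even_of_sq_add (m n k D : ℤ) (hD : D % 4 = 2 ∨ D % 4 = 3) (h : m^2-D*n^2 = 4*k) :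
    m % 2 = 0 ∧ n % 2 = 0 := by
  have hm : m % 4 = 0 ∨ m % 4 = 1 ∨ m % 4 = 2 ∨ m % 4 = 3 := by omega
  have hn : n % 4 = 0 ∨ n % 4 = 1 ∨ n % 4 = 2 ∨ n % 4 = 3 := by omega
  have h' : (m^2-D*n^2) % 4 = 0 := by omega
  rcases hD with hD | hD <;> rcases hm with hm | hm | hm | hm <;> rcases hn with hn | hn | hn | hn <;>
    simp [pow_two, Int.sub_emod, Int.mul_emod, hm, hn, hD] at h' ⊢ <;> omega

lemma even_of_even (m n k D : ℤ) (hD : D % 4 ≠ 0) (hm : m % 2 = 0) (h : m^2-D*n^2 = 4*k) :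
    n % 2 = 0 := by
  by_contra h0
  obtain ⟨j, rfl⟩ : ∃ j, m = 2*j := ⟨m/2, by omega⟩
  obtain ⟨i, rfl⟩ : ∃ i, n = 2*i+1 := ⟨n/2, by omega⟩
  have : D = 4*(j^2-k-D*(i^2+i)) := by linarith
  omega

/-- integral elements have half-integer coordinates, plus norm conditions -/
lemma coords (s : ℕ) (hsf : Squarefree s) (hs7 : 7 < s) (h7s : Squarefree (7*s)) (x : ℝ)
    (hx : x ∈ IntermediateField.adjoin ℚ {√(7:ℝ), √(s:ℝ)}) (hi : IsIntegral ℤ x) :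
    ∃ P Q R U : ℤ, 2*x = P+Q*√7+R*√s+U*(√7*√s) ∧
      (P^2+7*Q^2-s*R^2-7*s*U^2) % 4 = 0 ∧ (P*Q-s*(R*U)) % 2 = 0 := by
  have r7 : (√(7:ℝ))^2 = 7 := Real.sq_sqrt (by positivity)
  have rs : (√(s:ℝ))^2 = s := Real.sq_sqrt (by positivity)
  have sq7 : Squarefree 7 := (by norm_num : Nat.Prime 7).squarefree
  have s4 : (s:ℤ) % 4 ≠ 0 := by
    intro h
    have : 2*2 ∣ s := by omega
    have := hsf 2 this
    simp at this
  obtain ⟨a, b, c, d, rfl⟩ := mem_form s x hx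
  have i11 := conj_int s hsf hs7 h7s a b c d hi 1 1 (by norm_num) (by norm_num)
  have i10 := conj_int s hsf hs7 h7s a b c d hi 1 (-1) (by norm_num) (by norm_num)
  have i01 := conj_int s hsf hs7 h7s a b c d hi (-1) 1 (by norm_num) (by norm_num)
  have i00 := conj_int s hsf hs7 h7s a b c d hi (-1) (-1) (by norm_num) (by norm_num)
  have s7s : √((7*s : ℕ):ℝ) = √7*√s := by push_cast; exact Real.sqrt_mul (by norm_num) _
  obtain ⟨m, n, k, hm, hn, hk⟩ := quad_int 7 sq7 (2*a) (2*b)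
    (by exact int_congr (i11.add i10) (by push_cast; ring)) (by exact int_congr (i01.add i00) (by push_cast; ring))
  obtain ⟨m', n', k', hm', hn', hk'⟩ := quad_int s hsf (2*a) (2*c)
    (by exact int_congr (i11.add i01) (by push_cast; ring)) (by exact int_congr (i10.add i00) (by push_cast; ring))
  obtain ⟨m'', n'', k'', hm'', hn'', hk''⟩ := quad_int (7*s) h7s (2*a) (2*d)
    (by rw [s7s]; exact int_congr (i11.add i00) (by push_cast; ring))
    (by rw [s7s]; exact int_congr (i10.add i01) (by push_cast; ring))
  have e1 : m' = m := by rw [hm] at hm'; exact_mod_cast hm'.symm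
  have e2 : m'' = m := by rw [hm] at hm''; exact_mod_cast hm''.symm
  subst e1 e2
  obtain ⟨ev1, ev2⟩ := even_of_sq_add _ n k 7 (by norm_num) (by exact_mod_cast hk)
  have ev3 := even_of_even _ n' k' s s4 ev1 hk'
  have ev4 := even_of_even _ n'' k'' (7*s) (by omega) ev1 (by exact_mod_cast hk'')
  obtain ⟨P, rfl⟩ : ∃ j, m'' = 2*j := ⟨m''/2, by omega⟩
  obtain ⟨Q, rfl⟩ : ∃ j, n = 2*j := ⟨n/2, by omega⟩
  obtain ⟨R, rfl⟩ : ∃ j, n' = 2*j := ⟨n'/2, by omega⟩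
  obtain ⟨U, rfl⟩ : ∃ j, n'' = 2*j := ⟨n''/2, by omega⟩
  have ha : a = P/2 := by push_cast at hm; linarith
  have hb : b = Q/2 := by push_cast at hn; linarith
  have hc : c = R/2 := by push_cast at hn'; linarith
  have hd : d = U/2 := by push_cast at hn''; linarith
  refine ⟨P, Q, R, U, ?_, ?_⟩
  · rw [ha, hb, hc, hd]; push_cast; ring
  · obtain ⟨M, N, K, hM, hN, hK⟩ := quad_int 7 sq7 (a^2+7*b^2-s*c^2-7*s*d^2) (2*(a*b-s*(c*d)))
      (by
        refine int_congr (i11.mul i10) ?_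
        push_cast
        linear_combination (-(b:ℝ)^2+s*(d:ℝ)^2)*r7 + ((c:ℝ)+d*√7)^2*rs)
      (by
        refine int_congr (i01.mul i00) ?_
        push_cast
        linear_combination (-(b:ℝ)^2+s*(d:ℝ)^2)*r7 + ((c:ℝ)-d*√7)^2*rs)
    obtain ⟨o1, o2⟩ := even_of_sq_add M N K 7 (by norm_num) (by exact_mod_cast hK)
    have k1 : P^2+7*Q^2-s*R^2-7*s*U^2 = 2*M := by
      have : ((P^2+7*Q^2-s*R^2-7*s*U^2 : ℤ):ℚ) = ((2*M : ℤ):ℚ) := by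
        push_cast; rw [← hM, ha, hb, hc, hd]; ring
      exact_mod_cast this
    have k2 : P*Q-s*(R*U) = N := by
      have : ((P*Q-s*(R*U) : ℤ):ℚ) = (N:ℚ) := by
        push_cast; rw [← hN, ha, hb, hc, hd]; ring
      exact_mod_cast this
    constructor <;> omega

lemma no_two_sq_three (a b : ℤ) (h : a^2+b^2 = 3) : False := by
  have ha : a ≤ 1 := by nlinarith [sq_nonneg b]
  have ha' : -1 ≤ a := by nlinarith [sq_nonneg b]
  have hb : b ≤ 1 := by nlinarith [sq_nonneg a]
  have hb' : -1 ≤ b := by nlinarith [sq_nonneg a]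
  interval_cases a <;> interval_cases b <;> omega

lemma sq_ge_one_of_ne (a : ℤ) (h : a ≠ 0) : 1 ≤ a^2 := by
  have := sq_pos_of_ne_zero h
  omega

/-- at most one of the `q`s is nonzero. -/
lemma three_q (q0 q1 q2 : ℤ) (h : q0^2+q1^2+q2^2 ≤ 1) :
    (q0 = 0 ∧ q1 = 0 ∧ q2 = 0) ∨ (q0^2 = 1 ∧ q1 = 0 ∧ q2 = 0) ∨
    (q0 = 0 ∧ q1^2 = 1 ∧ q2 = 0) ∨ (q0 = 0 ∧ q1 = 0 ∧ q2^2 = 1) := by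
  by_cases h0 : q0 = 0 <;> by_cases h1 : q1 = 0 <;> by_cases h2 : q2 = 0
  all_goals
    try have a0 := sq_ge_one_of_ne q0 h0
    try have a1 := sq_ge_one_of_ne q1 h1
    try have a2 := sq_ge_one_of_ne q2 h2
    have b0 := sq_nonneg q0
    have b1 := sq_nonneg q1
    have b2 := sq_nonneg q2
    first
    | exact Or.inl ⟨h0, h1, h2⟩
    | exact Or.inr (Or.inl ⟨by omega, h1, h2⟩)
    | exact Or.inr (Or.inr (Or.inl ⟨h0, by omega, h2⟩))
    | exact Or.inr (Or.inr (Or.inr ⟨h0, h1, by omega⟩))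
    | omega

/-- `k p^2` when `p q = k`, `q^2 = 1`. -/
lemma sq_of_mul (p q k : ℤ) (h : p*q = k) (hq : q^2 = 1) : p^2 = k^2 := by
  have : p^2 * q^2 = k^2 := by rw [← h]; ring
  rw [hq] at this; linarith

lemma five_zero (a b c d e : ℤ) (h : a^2+b^2+c^2+d^2+e^2 < 1) :
    a = 0 ∧ b = 0 ∧ c = 0 ∧ d = 0 ∧ e = 0 := by
  have ha := sq_nonneg a
  have hb := sq_nonneg b
  have hc := sq_nonneg c
  have hd := sq_nonneg d
  have he := sq_nonneg e
  refine ⟨?_, ?_, ?_, ?_, ?_⟩ <;> (refine pow_eq_zero_iff (two_ne_zero) |>.1 ?_; omega)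

lemma five_pos (a b c d e a' b' c' d' e' k : ℤ) (h : a*a'+b*b'+c*c'+d*d'+e*e' = k) (hk : k ≠ 0) :
    1 ≤ a^2+b^2+c^2+d^2+e^2 := by
  by_contra hh
  obtain ⟨h1, h2, h3, h4, h5⟩ := five_zero a b c d e (by omega)
  subst h1 h2 h3 h4 h5
  simp at h
  exact hk h.symm

lemma five_pos' (a b c d e a' b' c' d' e' k : ℤ) (h : a*a'+b*b'+c*c'+d*d'+e*e' = k) (hk : k ≠ 0) :
    1 ≤ a'^2+b'^2+c'^2+d'^2+e'^2 :=
  five_pos a' b' c' d' e' a b c d e k (by linarith) hk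

lemma U_all (s P0 P1 P2 P3 P4 Q0 Q1 Q2 Q3 Q4 R0 R1 R2 R3 R4 U0 U1 U2 U3 U4 T : ℤ) (hs : 0 ≤ s)
    (E1 : (P0^2+7*Q0^2+s*R0^2+7*s*U0^2)+(P1^2+7*Q1^2+s*R1^2+7*s*U1^2)
      +(P2^2+7*Q2^2+s*R2^2+7*s*U2^2)+(P3^2+7*Q3^2+s*R3^2+7*s*U3^2)
      +(P4^2+7*Q4^2+s*R4^2+7*s*U4^2) = T) (hT : T < 7*s) :
    U0 = 0 ∧ U1 = 0 ∧ U2 = 0 ∧ U3 = 0 ∧ U4 = 0 := by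
  apply five_zero
  by_contra hh
  have h1 : 7*s*1 ≤ 7*s*(U0^2+U1^2+U2^2+U3^2+U4^2) :=
    mul_le_mul_of_nonneg_left (by omega) (by omega)
  have h2 : 0 ≤ P0^2+P1^2+P2^2+P3^2+P4^2+7*(Q0^2+Q1^2+Q2^2+Q3^2+Q4^2)
    +s*(R0^2+R1^2+R2^2+R3^2+R4^2) := by positivity
  linarith

lemma R_bound (R0 R1 R2 R3 R4 : ℤ)
    (r0 : 0 ≤ R0) (r1 : R0 ≤ R1) (r2 : R1 ≤ R2) (r3 : R2 ≤ R3) (r4 : R3 ≤ R4)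
    (hR : R0^2+R1^2+R2^2+R3^2+R4^2 ≤ 3) : R0 = 0 ∧ R1 = 0 ∧ R4 ≤ 1 := by
  have b0 := Int.le_self_sq R0
  have b1 := Int.le_self_sq R1
  have b2 := Int.le_self_sq R2
  have b3 := Int.le_self_sq R3
  refine ⟨by have := Int.le_self_sq R4; omega, by have := Int.le_self_sq R4; omega, ?_⟩
  by_contra h
  have : 2^2 ≤ R4^2 := by gcongr; omega
  omega

lemma core_three (p0 p1 p2 q0 q1 q2 N k : ℤ)
    (h1 : p0^2+p1^2+p2^2+7*(q0^2+q1^2+q2^2) = N)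
    (h2 : p0*q0+p1*q1+p2*q2 = k) (hk : k ≠ 0) (hN : N ≤ 14) :
    ∃ a b : ℤ, a^2+b^2 = N - 7 - k^2 := by
  have hpos := five_pos p0 p1 p2 0 0 q0 q1 q2 0 0 k (by linarith) hk
  have hq := three_q q0 q1 q2 (by omega)
  rcases hq with ⟨a,b,c⟩ | ⟨a,b,c⟩ | ⟨a,b,c⟩ | ⟨a,b,c⟩
  · subst a b c; simp at h2; exact absurd h2.symm hk
  · subst b c; have := sq_of_mul p0 q0 k (by linarith) a; exact ⟨p1, p2, by linarith⟩
  · subst a c; have := sq_of_mul p1 q1 k (by linarith) b; exact ⟨p0, p2, by linarith⟩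
  · subst a b; have := sq_of_mul p2 q2 k (by linarith) c; exact ⟨p0, p1, by linarith⟩

lemma fin1 (p0 p1 p2 q0 q1 q2 q3 P3 : ℤ)
    (H1 : 4*(p0^2+p1^2+p2^2)+P3^2+(4-P3)^2+28*(q0^2+q1^2+q2^2+2*q3^2) = 54)
    (H2 : 2*(p0*q0+p1*q1+p2*q2)+P3*q3-(4-P3)*q3 = 2) (hP : P3 % 2 = 1) : False := by
  have n0 := sq_nonneg q0
  have n1 := sq_nonneg q1
  have n2 := sq_nonneg q2
  have m0 := sq_nonneg p0
  have m1 := sq_nonneg p1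
  have m2 := sq_nonneg p2
  have hq3 : q3 = 0 := by
    by_contra h0
    have := sq_ge_one_of_ne _ h0
    have := sq_nonneg P3
    have := sq_nonneg (4-P3)
    omega
  subst hq3
  have F2 : p0*q0+p1*q1+p2*q2 = 1 := by linarith
  have l0 : P3^2+(4-P3)^2 ≤ 54 := by linarith
  have l1 : P3 ≤ 6 := by clear H1 H2 F2; nlinarith
  have l2 : -2 ≤ P3 := by clear H1 H2 F2; nlinarith
  have key : ∀ N, P3^2+(4-P3)^2 = 54 - 4*N → p0^2+p1^2+p2^2+7*(q0^2+q1^2+q2^2) = N := by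
    intro N hN; linarith
  have : P3 = 1 ∨ P3 = 3 ∨ P3 = -1 ∨ P3 = 5 := by omega
  rcases this with rfl | rfl | rfl | rfl
  · obtain ⟨a, b, h⟩ := core_three p0 p1 p2 q0 q1 q2 11 1 (key 11 (by norm_num)) F2 (by norm_num) (by norm_num)
    exact no_two_sq_three a b (by linarith)
  · obtain ⟨a, b, h⟩ := core_three p0 p1 p2 q0 q1 q2 11 1 (key 11 (by norm_num)) F2 (by norm_num) (by norm_num)
    exact no_two_sq_three a b (by linarith)
  · obtain ⟨a, b, h⟩ := core_three p0 p1 p2 q0 q1 q2 7 1 (key 7 (by norm_num)) F2 (by norm_num) (by norm_num)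
    nlinarith [sq_nonneg a, sq_nonneg b]
  · obtain ⟨a, b, h⟩ := core_three p0 p1 p2 q0 q1 q2 7 1 (key 7 (by norm_num)) F2 (by norm_num) (by norm_num)
    nlinarith [sq_nonneg a, sq_nonneg b]

/-- Case s ≡ 1 mod 4. -/
lemma core1 (s : ℤ) (hs : 13 ≤ s)
    (P0 P1 P2 P3 P4 Q0 Q1 Q2 Q3 Q4 R0 R1 R2 R3 R4 U0 U1 U2 U3 U4 : ℤ)
    (E1 : (P0^2+7*Q0^2+s*R0^2+7*s*U0^2)+(P1^2+7*Q1^2+s*R1^2+7*s*U1^2)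
      +(P2^2+7*Q2^2+s*R2^2+7*s*U2^2)+(P3^2+7*Q3^2+s*R3^2+7*s*U3^2)
      +(P4^2+7*Q4^2+s*R4^2+7*s*U4^2) = 54+2*s)
    (E2 : (P0*Q0+s*(R0*U0))+(P1*Q1+s*(R1*U1))+(P2*Q2+s*(R2*U2))
      +(P3*Q3+s*(R3*U3))+(P4*Q4+s*(R4*U4)) = 4)
    (E3 : (P0*R0+7*(Q0*U0))+(P1*R1+7*(Q1*U1))+(P2*R2+7*(Q2*U2))
      +(P3*R3+7*(Q3*U3))+(P4*R4+7*(Q4*U4)) = 4)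
    (E4 : (P0*U0+Q0*R0)+(P1*U1+Q1*R1)+(P2*U2+Q2*R2)
      +(P3*U3+Q3*R3)+(P4*U4+Q4*R4) = 0)
    (r0 : 0 ≤ R0) (r1 : R0 ≤ R1) (r2 : R1 ≤ R2) (r3 : R2 ≤ R3) (r4 : R3 ≤ R4)
    (a0 : P0 % 2 = R0 % 2 ∧ Q0 % 2 = U0 % 2)
    (a1 : P1 % 2 = R1 % 2 ∧ Q1 % 2 = U1 % 2)
    (a2 : P2 % 2 = R2 % 2 ∧ Q2 % 2 = U2 % 2)
    (a3 : P3 % 2 = R3 % 2 ∧ Q3 % 2 = U3 % 2)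
    (a4 : P4 % 2 = R4 % 2 ∧ Q4 % 2 = U4 % 2) : False := by
  obtain ⟨hu0, hu1, hu2, hu3, hu4⟩ := U_all s _ _ _ _ _ _ _ _ _ _ _ _ _ _ _ _ _ _ _ _ _ (by omega) E1 (by omega)
  subst hu0 hu1 hu2 hu3 hu4
  obtain ⟨q0, rfl⟩ : ∃ q, Q0 = 2*q := ⟨Q0/2, by omega⟩
  obtain ⟨q1, rfl⟩ : ∃ q, Q1 = 2*q := ⟨Q1/2, by omega⟩
  obtain ⟨q2, rfl⟩ : ∃ q, Q2 = 2*q := ⟨Q2/2, by omega⟩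
  obtain ⟨q3, rfl⟩ : ∃ q, Q3 = 2*q := ⟨Q3/2, by omega⟩
  obtain ⟨q4, rfl⟩ : ∃ q, Q4 = 2*q := ⟨Q4/2, by omega⟩
  have E1' : (P0^2+P1^2+P2^2+P3^2+P4^2) + 28*(q0^2+q1^2+q2^2+q3^2+q4^2)
    + s*(R0^2+R1^2+R2^2+R3^2+R4^2) = 54+2*s := by linarith
  have E2' : P0*q0+P1*q1+P2*q2+P3*q3+P4*q4 = 2 := by linarith
  have hq : 1 ≤ q0^2+q1^2+q2^2+q3^2+q4^2 := five_pos' _ _ _ _ _ _ _ _ _ _ _ E2' (by norm_num)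
  have hp : 1 ≤ P0^2+P1^2+P2^2+P3^2+P4^2 := five_pos _ _ _ _ _ _ _ _ _ _ _ E2' (by norm_num)
  have hR : R0^2+R1^2+R2^2+R3^2+R4^2 ≤ 3 := by
    by_contra hh
    have : s*4 ≤ s*(R0^2+R1^2+R2^2+R3^2+R4^2) := mul_le_mul_of_nonneg_left (by omega) (by omega)
    linarith
  obtain ⟨hR0, hR1, hR4⟩ := R_bound R0 R1 R2 R3 R4 r0 r1 r2 r3 r4 hR
  subst hR0 hR1
  have c2 : R2 = 0 := by
    by_contra h0
    have : R2 = 1 := by omega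
    have : R3 = 1 := by omega
    have : R4 = 1 := by omega
    subst R2 R3 R4
    omega
  subst c2
  have c3 : R3 = 1 := by
    by_contra h0
    have : R3 = 0 := by omega
    subst this
    have : R4 = 0 ∨ R4 = 1 := by omega
    rcases this with rfl | rfl <;> omega
  subst c3
  have c4 : R4 = 1 := by omega
  subst c4
  obtain ⟨p0, rfl⟩ : ∃ q, P0 = 2*q := ⟨P0/2, by omega⟩
  obtain ⟨p1, rfl⟩ : ∃ q, P1 = 2*q := ⟨P1/2, by omega⟩
  obtain ⟨p2, rfl⟩ : ∃ q, P2 = 2*q := ⟨P2/2, by omega⟩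
  have e4 : q4 = -q3 := by linarith
  have e3 : P4 = 4 - P3 := by linarith
  subst e4 e3
  exact fin1 p0 p1 p2 q0 q1 q2 q3 P3 (by linarith) (by linarith) (by omega)

lemma R_four (R0 R1 R2 R3 R4 : ℤ)
    (r0 : 0 ≤ R0) (r1 : R0 ≤ R1) (r2 : R1 ≤ R2) (r3 : R2 ≤ R3) (r4 : R3 ≤ R4)
    (hR : R0^2+R1^2+R2^2+R3^2+R4^2 = 4) :
    (R0 = 0 ∧ R1 = 0 ∧ R2 = 0 ∧ R3 = 0 ∧ R4 = 2) ∨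
    (R0 = 0 ∧ R1 = 1 ∧ R2 = 1 ∧ R3 = 1 ∧ R4 = 1) := by
  have b0 := sq_nonneg R0
  have b1 := sq_nonneg R1
  have b2 := sq_nonneg R2
  have b3 := sq_nonneg R3
  have h4 : R4 ≤ 2 := by nlinarith
  have h4' : 0 ≤ R4 := by omega
  interval_cases R4
  · have : R0 = 0 := by omega
    have : R1 = 0 := by omega
    have : R2 = 0 := by omega
    have : R3 = 0 := by omega
    subst R0 R1 R2 R3
    omega
  · have : R3 = 0 ∨ R3 = 1 := by omega
    have : R2 = 0 ∨ R2 = 1 := by omega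
    have : R1 = 0 ∨ R1 = 1 := by omega
    have : R0 = 0 ∨ R0 = 1 := by omega
    rcases ‹R3 = 0 ∨ R3 = 1› with rfl | rfl <;> rcases ‹R2 = 0 ∨ R2 = 1› with rfl | rfl <;>
    rcases ‹R1 = 0 ∨ R1 = 1› with rfl | rfl <;> rcases ‹R0 = 0 ∨ R0 = 1› with rfl | rfl <;> omega
  · left
    refine ⟨?_, ?_, ?_, ?_, rfl⟩ <;> (refine pow_eq_zero_iff (two_ne_zero) |>.1 ?_; omega)

lemma fin3 (p0 p1 p2 p3 q0 q1 q2 Q3 : ℤ)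
    (H1 : 4*(p0^2+p1^2+p2^2+p3^2+(1-p3)^2)+28*(q0^2+q1^2+q2^2)+7*(Q3^2+(2-Q3)^2) = 62)
    (H2 : 2*(p0*q0+p1*q1+p2*q2)+p3*Q3+(1-p3)*(2-Q3) = 3) (hP : Q3 % 2 = 1) : False := by
  have n0 := sq_nonneg q0
  have n1 := sq_nonneg q1
  have n2 := sq_nonneg q2
  have m0 := sq_nonneg p0
  have m1 := sq_nonneg p1
  have m2 := sq_nonneg p2
  have m3 := sq_nonneg p3
  have m4 := sq_nonneg (1-p3)
  have l0 : 7*(Q3^2+(2-Q3)^2) ≤ 62 := by linarith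
  have l1 : Q3 ≤ 2 := by clear H1 H2; nlinarith
  have l2 : 0 ≤ Q3 := by clear H1 H2; nlinarith
  have : Q3 = 1 := by omega
  subst this
  obtain ⟨a, b, h⟩ := core_three p0 p1 p2 q0 q1 q2 (12 - p3^2-(1-p3)^2) 1 (by linarith) (by linarith)
    (by norm_num) (by linarith)
  have na := sq_nonneg a
  have nb := sq_nonneg b
  have l3 : p3^2+(1-p3)^2 ≤ 4 := by linarith
  have l4 : p3 ≤ 1 := by clear H1 H2; nlinarith
  have l5 : 0 ≤ p3 := by clear H1 H2; nlinarith
  have : p3 = 0 ∨ p3 = 1 := by omega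
  rcases this with rfl | rfl
  · exact no_two_sq_three a b (by linarith)
  · exact no_two_sq_three a b (by linarith)

lemma fin11 (p0 p1 p2 p3 q0 q1 q2 Q3 : ℤ)
    (H1 : 4*(p0^2+p1^2+p2^2+p3^2+(1-p3)^2)+28*(q0^2+q1^2+q2^2)+7*(Q3^2+(2-Q3)^2) = 74)
    (H2 : 2*(p0*q0+p1*q1+p2*q2)+p3*Q3+(1-p3)*(2-Q3) = 5) (hP : Q3 % 2 = 1) : False := by
  have n0 := sq_nonneg q0
  have n1 := sq_nonneg q1
  have n2 := sq_nonneg q2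
  have m0 := sq_nonneg p0
  have m1 := sq_nonneg p1
  have m2 := sq_nonneg p2
  have m3 := sq_nonneg p3
  have m4 := sq_nonneg (1-p3)
  have l0 : 7*(Q3^2+(2-Q3)^2) ≤ 74 := by linarith
  have l1 : Q3 ≤ 3 := by clear H1 H2; nlinarith
  have l2 : -1 ≤ Q3 := by clear H1 H2; nlinarith
  have hp3 : 1 ≤ p3^2+(1-p3)^2 := by
    by_contra hh
    have e1 : p3^2 = 0 := by omega
    have e2 : (1-p3)^2 = 0 := by omega
    have e1 := pow_eq_zero_iff (two_ne_zero) |>.1 e1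
    have e2 := pow_eq_zero_iff (two_ne_zero) |>.1 e2
    omega
  have : Q3 = 1 ∨ Q3 = -1 ∨ Q3 = 3 := by omega
  rcases this with h | h
  · subst h
    obtain ⟨a, b, h⟩ := core_three p0 p1 p2 q0 q1 q2 (15 - p3^2-(1-p3)^2) 2 (by linarith) (by linarith)
      (by norm_num) (by linarith)
    have na := sq_nonneg a
    have nb := sq_nonneg b
    have l3 : p3^2+(1-p3)^2 ≤ 4 := by linarith
    have l4 : p3 ≤ 1 := by clear H1 H2; nlinarith
    have l5 : 0 ≤ p3 := by clear H1 H2; nlinarith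
    have : p3 = 0 ∨ p3 = 1 := by omega
    rcases this with rfl | rfl
    · exact no_two_sq_three a b (by linarith)
    · exact no_two_sq_three a b (by linarith)
  · have hz : 7*(Q3^2+(2-Q3)^2) = 70 := by rcases h with rfl | rfl <;> norm_num
    obtain ⟨rfl, rfl, rfl, -, -⟩ := five_zero q0 q1 q2 0 0 (by omega)
    rcases h with rfl | rfl <;> omega

lemma five_AG (a b c : ℤ) (ha : 0 < a) (h : c^2 ≤ 4*a*b) (p0 p1 p2 p3 p4 q0 q1 q2 q3 q4 : ℤ) :
    c*(p0*q0+p1*q1+p2*q2+p3*q3+p4*q4) ≤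
      a*(p0^2+p1^2+p2^2+p3^2+p4^2)+b*(q0^2+q1^2+q2^2+q3^2+q4^2) := by
  have key : ∀ p q : ℤ, c*(p*q) ≤ a*p^2+b*q^2 := by
    intro p q
    have : 0 ≤ 4*a*(a*p^2+b*q^2-c*(p*q)) := by nlinarith [sq_nonneg (2*a*p-c*q), mul_nonneg (sub_nonneg.2 h) (sq_nonneg q)]
    linarith [(mul_nonneg_iff_of_pos_left (by positivity : 0 < 4*a)).1 this]
  linarith [key p0 q0, key p1 q1, key p2 q2, key p3 q3, key p4 q4]

lemma sq_mod_four (a b : ℤ) (h : a % 2 = b % 2) : a^2 % 4 = b^2 % 4 := by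
  obtain ⟨k, rfl⟩ : ∃ k, a = b + 2*k := ⟨(a-b)/2, by omega⟩
  have : (b+2*k)^2 = b^2 + 4*(b*k+k^2) := by ring
  omega

lemma odd_sq (a : ℤ) (h : a % 2 = 1) : 1 ≤ a^2 := sq_ge_one_of_ne a (by rintro rfl; simp at h)

/-- Case s ≡ 3 mod 4. -/
lemma core3 (s : ℤ) (hs : 15 ≤ s)
    (P0 P1 P2 P3 P4 Q0 Q1 Q2 Q3 Q4 R0 R1 R2 R3 R4 U0 U1 U2 U3 U4 : ℤ)
    (E1 : (P0^2+7*Q0^2+s*R0^2+7*s*U0^2)+(P1^2+7*Q1^2+s*R1^2+7*s*U1^2)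
      +(P2^2+7*Q2^2+s*R2^2+7*s*U2^2)+(P3^2+7*Q3^2+s*R3^2+7*s*U3^2)
      +(P4^2+7*Q4^2+s*R4^2+7*s*U4^2) = 62+2*s)
    (E2 : (P0*Q0+s*(R0*U0))+(P1*Q1+s*(R1*U1))+(P2*Q2+s*(R2*U2))
      +(P3*Q3+s*(R3*U3))+(P4*Q4+s*(R4*U4)) = 6)
    (E3 : (P0*R0+7*(Q0*U0))+(P1*R1+7*(Q1*U1))+(P2*R2+7*(Q2*U2))
      +(P3*R3+7*(Q3*U3))+(P4*R4+7*(Q4*U4)) = 2)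
    (E4 : (P0*U0+Q0*R0)+(P1*U1+Q1*R1)+(P2*U2+Q2*R2)
      +(P3*U3+Q3*R3)+(P4*U4+Q4*R4) = 2)
    (r0 : 0 ≤ R0) (r1 : R0 ≤ R1) (r2 : R1 ≤ R2) (r3 : R2 ≤ R3) (r4 : R3 ≤ R4)
    (a0 : P0 % 2 = U0 % 2 ∧ Q0 % 2 = R0 % 2)
    (a1 : P1 % 2 = U1 % 2 ∧ Q1 % 2 = R1 % 2)
    (a2 : P2 % 2 = U2 % 2 ∧ Q2 % 2 = R2 % 2)
    (a3 : P3 % 2 = U3 % 2 ∧ Q3 % 2 = R3 % 2)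
    (a4 : P4 % 2 = U4 % 2 ∧ Q4 % 2 = R4 % 2) : False := by
  obtain ⟨hu0, hu1, hu2, hu3, hu4⟩ := U_all s _ _ _ _ _ _ _ _ _ _ _ _ _ _ _ _ _ _ _ _ _ (by omega) E1 (by omega)
  subst hu0 hu1 hu2 hu3 hu4
  obtain ⟨p0, rfl⟩ : ∃ q, P0 = 2*q := ⟨P0/2, by omega⟩
  obtain ⟨p1, rfl⟩ : ∃ q, P1 = 2*q := ⟨P1/2, by omega⟩
  obtain ⟨p2, rfl⟩ : ∃ q, P2 = 2*q := ⟨P2/2, by omega⟩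
  obtain ⟨p3, rfl⟩ : ∃ q, P3 = 2*q := ⟨P3/2, by omega⟩
  obtain ⟨p4, rfl⟩ : ∃ q, P4 = 2*q := ⟨P4/2, by omega⟩
  have E1' : 4*(p0^2+p1^2+p2^2+p3^2+p4^2) + 7*(Q0^2+Q1^2+Q2^2+Q3^2+Q4^2)
    + s*(R0^2+R1^2+R2^2+R3^2+R4^2) = 62+2*s := by linarith
  have E2' : p0*Q0+p1*Q1+p2*Q2+p3*Q3+p4*Q4 = 3 := by linarith
  have AG := five_AG 4 7 10 (by norm_num) (by norm_num) p0 p1 p2 p3 p4 Q0 Q1 Q2 Q3 Q4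
  have hR5 : R0^2+R1^2+R2^2+R3^2+R4^2 ≤ 4 := by
    by_contra hh
    have : s*5 ≤ s*(R0^2+R1^2+R2^2+R3^2+R4^2) := mul_le_mul_of_nonneg_left (by omega) (by omega)
    linarith
  have hR : R0^2+R1^2+R2^2+R3^2+R4^2 ≤ 3 := by
    by_contra hh
    have h4 : R0^2+R1^2+R2^2+R3^2+R4^2 = 4 := by omega
    rcases R_four R0 R1 R2 R3 R4 r0 r1 r2 r3 r4 h4 with ⟨rfl, rfl, rfl, rfl, rfl⟩ | ⟨rfl, rfl, rfl, rfl, rfl⟩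
    · omega
    · have AG2 := five_AG 4 1 4 (by norm_num) (by norm_num) p0 p1 p2 p3 p4 Q0 Q1 Q2 Q3 Q4
      have := odd_sq Q1 (by omega)
      have := odd_sq Q2 (by omega)
      have := odd_sq Q3 (by omega)
      have := odd_sq Q4 (by omega)
      have := sq_nonneg Q0
      rw [h4] at E1'
      rw [E2'] at AG AG2
      omega
  obtain ⟨hR0, hR1, hR4⟩ := R_bound R0 R1 R2 R3 R4 r0 r1 r2 r3 r4 hR
  subst hR0 hR1
  have c2 : R2 = 0 := by
    by_contra h0
    have : R2 = 1 := by omega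
    have : R3 = 1 := by omega
    have : R4 = 1 := by omega
    subst R2 R3 R4
    omega
  subst c2
  have c3 : R3 = 1 := by
    by_contra h0
    have : R3 = 0 := by omega
    subst this
    have : R4 = 0 ∨ R4 = 1 := by omega
    rcases this with rfl | rfl <;> omega
  subst c3
  have c4 : R4 = 1 := by omega
  subst c4
  obtain ⟨q0, rfl⟩ : ∃ q, Q0 = 2*q := ⟨Q0/2, by omega⟩
  obtain ⟨q1, rfl⟩ : ∃ q, Q1 = 2*q := ⟨Q1/2, by omega⟩
  obtain ⟨q2, rfl⟩ : ∃ q, Q2 = 2*q := ⟨Q2/2, by omega⟩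
  have e4 : Q4 = 2-Q3 := by linarith
  have e3 : p4 = 1-p3 := by linarith
  subst e4 e3
  exact fin3 p0 p1 p2 p3 q0 q1 q2 Q3 (by linarith) (by linarith) (by omega)

set_option maxHeartbeats 2000000 in
/-- Case s = 11. -/
lemma core11
    (P0 P1 P2 P3 P4 Q0 Q1 Q2 Q3 Q4 R0 R1 R2 R3 R4 U0 U1 U2 U3 U4 : ℤ)
    (E1 : (P0^2+7*Q0^2+11*R0^2+77*U0^2)+(P1^2+7*Q1^2+11*R1^2+77*U1^2)
      +(P2^2+7*Q2^2+11*R2^2+77*U2^2)+(P3^2+7*Q3^2+11*R3^2+77*U3^2)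
      +(P4^2+7*Q4^2+11*R4^2+77*U4^2) = 96)
    (E2 : (P0*Q0+11*(R0*U0))+(P1*Q1+11*(R1*U1))+(P2*Q2+11*(R2*U2))
      +(P3*Q3+11*(R3*U3))+(P4*Q4+11*(R4*U4)) = 10)
    (E3 : (P0*R0+7*(Q0*U0))+(P1*R1+7*(Q1*U1))+(P2*R2+7*(Q2*U2))
      +(P3*R3+7*(Q3*U3))+(P4*R4+7*(Q4*U4)) = 2)
    (E4 : (P0*U0+Q0*R0)+(P1*U1+Q1*R1)+(P2*U2+Q2*R2)
      +(P3*U3+Q3*R3)+(P4*U4+Q4*R4) = 2)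
    (r0 : 0 ≤ R0) (r1 : R0 ≤ R1) (r2 : R1 ≤ R2) (r3 : R2 ≤ R3) (r4 : R3 ≤ R4)
    (a0 : P0 % 2 = U0 % 2 ∧ Q0 % 2 = R0 % 2)
    (a1 : P1 % 2 = U1 % 2 ∧ Q1 % 2 = R1 % 2)
    (a2 : P2 % 2 = U2 % 2 ∧ Q2 % 2 = R2 % 2)
    (a3 : P3 % 2 = U3 % 2 ∧ Q3 % 2 = R3 % 2)
    (a4 : P4 % 2 = U4 % 2 ∧ Q4 % 2 = R4 % 2) : False := by
  have f0 := sq_mod_four _ _ a0.1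
  have f1 := sq_mod_four _ _ a1.1
  have f2 := sq_mod_four _ _ a2.1
  have f3 := sq_mod_four _ _ a3.1
  have f4 := sq_mod_four _ _ a4.1
  have g0 := sq_mod_four _ _ a0.2
  have g1 := sq_mod_four _ _ a1.2
  have g2 := sq_mod_four _ _ a2.2
  have g3 := sq_mod_four _ _ a3.2
  have g4 := sq_mod_four _ _ a4.2
  obtain ⟨SP, hSP⟩ : ∃ t, t = P0^2+P1^2+P2^2+P3^2+P4^2 := ⟨_, rfl⟩
  obtain ⟨SQ, hSQ⟩ : ∃ t, t = Q0^2+Q1^2+Q2^2+Q3^2+Q4^2 := ⟨_, rfl⟩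
  obtain ⟨SR, hSR⟩ : ∃ t, t = R0^2+R1^2+R2^2+R3^2+R4^2 := ⟨_, rfl⟩
  obtain ⟨SU, hSU⟩ : ∃ t, t = U0^2+U1^2+U2^2+U3^2+U4^2 := ⟨_, rfl⟩
  have E1' : SP + 7*SQ+11*SR+77*SU = 96 := by rw [hSP, hSQ, hSR, hSU]; linarith
  have z1 : 0 ≤ SP := by rw [hSP]; positivity
  have z2 : 0 ≤ SQ := by rw [hSQ]; positivity
  have z3 : 0 ≤ SR := by rw [hSR]; positivity
  have z4 : 0 ≤ SU := by rw [hSU]; positivity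
  have m1 : SP % 4 = SU % 4 := by omega
  have m2 : SQ % 4 = SR % 4 := by omega
  clear f0 f1 f2 f3 f4 g0 g1 g2 g3 g4
  have hU : SU = 0 ∨ SU = 1 := by omega
  rcases hU with hU | hU
  · obtain ⟨rfl, rfl, rfl, rfl, rfl⟩ := five_zero U0 U1 U2 U3 U4 (by omega)
    obtain ⟨p0, rfl⟩ : ∃ q, P0 = 2*q := ⟨P0/2, by omega⟩
    obtain ⟨p1, rfl⟩ : ∃ q, P1 = 2*q := ⟨P1/2, by omega⟩
    obtain ⟨p2, rfl⟩ : ∃ q, P2 = 2*q := ⟨P2/2, by omega⟩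
    obtain ⟨p3, rfl⟩ : ∃ q, P3 = 2*q := ⟨P3/2, by omega⟩
    obtain ⟨p4, rfl⟩ : ∃ q, P4 = 2*q := ⟨P4/2, by omega⟩
    have AG := five_AG 8 14 21 (by norm_num) (by norm_num) p0 p1 p2 p3 p4 Q0 Q1 Q2 Q3 Q4
    have E2' : p0*Q0+p1*Q1+p2*Q2+p3*Q3+p4*Q4 = 5 := by linarith
    rw [E2'] at AG
    have hSP' : SP = 4*(p0^2+p1^2+p2^2+p3^2+p4^2) := by rw [hSP]; ring
    have hR : R0^2+R1^2+R2^2+R3^2+R4^2 ≤ 3 := by omega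
    clear m1 m2
    obtain ⟨hR0, hR1, hR4⟩ := R_bound R0 R1 R2 R3 R4 r0 r1 r2 r3 r4 hR
    subst hR0 hR1
    have c2 : R2 = 0 := by
      by_contra h0
      have : R2 = 1 := by omega
      have : R3 = 1 := by omega
      have : R4 = 1 := by omega
      subst R2 R3 R4
      omega
    subst c2
    have c3 : R3 = 1 := by
      by_contra h0
      have : R3 = 0 := by omega
      subst this
      have : R4 = 0 ∨ R4 = 1 := by omega
      rcases this with rfl | rfl <;> omega
    subst c3
    have c4 : R4 = 1 := by omega
    subst c4
    obtain ⟨q0, rfl⟩ : ∃ q, Q0 = 2*q := ⟨Q0/2, by omega⟩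
    obtain ⟨q1, rfl⟩ : ∃ q, Q1 = 2*q := ⟨Q1/2, by omega⟩
    obtain ⟨q2, rfl⟩ : ∃ q, Q2 = 2*q := ⟨Q2/2, by omega⟩
    have e4 : Q4 = 2-Q3 := by linarith
    have e3 : p4 = 1-p3 := by linarith
    subst e4 e3
    exact fin11 p0 p1 p2 p3 q0 q1 q2 Q3 (by linarith) (by linarith) (by omega)
  · have k1 : SR = 1 := by omega
    have k2 : SQ = 1 := by omega
    have k3 : SP = 1 := by omega
    obtain ⟨hR0, hR1, hR4⟩ := R_bound R0 R1 R2 R3 R4 r0 r1 r2 r3 r4 (by omega)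
    have hR4' : R4 = 1 := by
      by_contra h0
      have : R4 = 0 := by omega
      have : R3 = 0 := by omega
      have : R2 = 0 := by omega
      subst R0 R1 R2 R3 R4
      omega
    subst hR4'
    obtain ⟨rfl, rfl, rfl, rfl, -⟩ := five_zero R0 R1 R2 R3 0 (by omega)
    have o4 := odd_sq Q4 (by omega)
    have w0 := sq_nonneg P0
    have w1 := sq_nonneg P1
    have w2 := sq_nonneg P2
    have w3 := sq_nonneg P3
    have v0 := sq_nonneg U0
    have v1 := sq_nonneg U1
    have v2 := sq_nonneg U2
    have v3 := sq_nonneg U3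
    have hP4 : P4^2 ≤ 1 := by omega
    have hU4 : U4^2 ≤ 1 := by omega
    have hQ4 : Q4^2 ≤ 1 := by
      have := sq_nonneg Q0
      have := sq_nonneg Q1
      have := sq_nonneg Q2
      have := sq_nonneg Q3
      omega
    obtain ⟨rfl, rfl, rfl, rfl, -⟩ := five_zero Q0 Q1 Q2 Q3 0 (by omega)
    clear m1 m2
    have := abs_le_one_iff_mul_self_le_one.2 (by rw [← sq]; exact hP4 : P4*P4 ≤ 1)
    rw [abs_le] at this
    have := abs_le_one_iff_mul_self_le_one.2 (by rw [← sq]; exact hU4 : U4*U4 ≤ 1)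
    rw [abs_le] at this
    have := abs_le_one_iff_mul_self_le_one.2 (by rw [← sq]; exact hQ4 : Q4*Q4 ≤ 1)
    rw [abs_le] at this
    have hP : P4 = -1 ∨ P4 = 0 ∨ P4 = 1 := by omega
    have hQ : Q4 = -1 ∨ Q4 = 1 := by omega
    clear E1 hSP hSQ hSR hSU E1' E4 z1 z2 z3 z4 o4 hP4 hU4 hQ4
    rcases hP with rfl | rfl | rfl <;> rcases hQ with rfl | rfl <;> omega

lemma fin2 (p0 p1 p2 p3 p4 q0 q1 q2 q3 q4 : ℤ)
    (H1 : p0^2+p1^2+p2^2+p3^2+p4^2+7*(q0^2+q1^2+q2^2+q3^2+q4^2) = 12)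
    (H2 : p0*q0+p1*q1+p2*q2+p3*q3+p4*q4 = 1)
    (H3 : p3+2*p4+7*q3 = 2) (H4 : p3+q3+2*q4 = 0) : False := by
  have m : 0 ≤ p0^2+p1^2+p2^2+p3^2+p4^2 := by positivity
  have n0 := sq_nonneg q0
  have n1 := sq_nonneg q1
  have n2 := sq_nonneg q2
  have n3 := sq_nonneg q3
  have n4 := sq_nonneg q4
  by_cases h3 : q3 = 0
  · subst h3
    by_cases h4 : q4 = 0
    · subst h4
      have : p3 = 0 := by omega
      have : p4 = 1 := by omega
      subst p3 p4
      obtain ⟨a, b, h⟩ := core_three p0 p1 p2 q0 q1 q2 11 1 (by linarith) (by linarith) (by norm_num) (by norm_num)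
      exact no_two_sq_three a b (by linarith)
    · have := sq_ge_one_of_ne _ h4
      obtain ⟨rfl, rfl, rfl, -, -⟩ := five_zero q0 q1 q2 0 0 (by omega)
      have e4 : q4^2 = 1 := by omega
      have : p4 = 1+q4 := by omega
      subst this
      have : q4 = 0 := by linarith
      exact h4 this
  · have := sq_ge_one_of_ne _ h3
    obtain ⟨rfl, rfl, rfl, rfl, -⟩ := five_zero q0 q1 q2 q4 0 (by omega)
    have : p3 = -q3 := by omega
    subst this
    have e4 : q3^2 = 1 := by omega
    linarith

lemma R_five (R0 R1 R2 R3 R4 : ℤ)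
    (r0 : 0 ≤ R0) (r1 : R0 ≤ R1) (r2 : R1 ≤ R2) (r3 : R2 ≤ R3) (r4 : R3 ≤ R4)
    (hR : R0^2+R1^2+R2^2+R3^2+R4^2 = 5) :
    (R0 = 0 ∧ R1 = 0 ∧ R2 = 0 ∧ R3 = 1 ∧ R4 = 2) ∨
    (R0 = 1 ∧ R1 = 1 ∧ R2 = 1 ∧ R3 = 1 ∧ R4 = 1) := by
  have b0 := sq_nonneg R0
  have b1 := sq_nonneg R1
  have b2 := sq_nonneg R2
  have b3 := sq_nonneg R3
  have h4 : R4 ≤ 2 := by nlinarith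
  have h4' : 1 ≤ R4 := by
    by_contra h
    have : R4 = 0 := by omega
    have : R0 = 0 := by omega
    have : R1 = 0 := by omega
    have : R2 = 0 := by omega
    have : R3 = 0 := by omega
    subst R0 R1 R2 R3 R4
    omega
  have h3 : R3 ≤ 1 := by
    by_contra h
    have : 2^2 ≤ R3^2 := by gcongr; omega
    have : 2^2 ≤ R4^2 := by gcongr; omega
    omega
  have : R4 = 1 ∨ R4 = 2 := by omega
  have : R3 = 0 ∨ R3 = 1 := by omega
  have : R2 = 0 ∨ R2 = 1 := by omega
  have : R1 = 0 ∨ R1 = 1 := by omega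
  have : R0 = 0 ∨ R0 = 1 := by omega
  rcases ‹R3 = 0 ∨ R3 = 1› with rfl | rfl <;> rcases ‹R2 = 0 ∨ R2 = 1› with rfl | rfl <;>
  rcases ‹R1 = 0 ∨ R1 = 1› with rfl | rfl <;> rcases ‹R0 = 0 ∨ R0 = 1› with rfl | rfl <;>
  rcases ‹R4 = 1 ∨ R4 = 2› with rfl | rfl <;> omega

lemma sq_one_cases (a : ℤ) (h : a^2 = 1) : a = 1 ∨ a = -1 := by
  rcases Int.isUnit_iff.1 (IsUnit.of_pow_eq_one h two_ne_zero) with h | h <;> simp [h]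

lemma mul_mod_two (a b : ℤ) (h : a % 2 = b % 2) : (a*b) % 2 = b^2 % 2 := by
  obtain ⟨k, rfl⟩ : ∃ k, a = b + 2*k := ⟨(a-b)/2, by omega⟩
  have : (b+2*k)*b = b^2 + 2*(b*k) := by ring
  omega

set_option maxHeartbeats 2000000 in
/-- Case s ≡ 2 mod 4. -/
lemma core2 (s : ℤ) (hs : 10 ≤ s) (hs4 : s % 4 = 2)
    (p0 p1 p2 p3 p4 q0 q1 q2 q3 q4 R0 R1 R2 R3 R4 U0 U1 U2 U3 U4 : ℤ)
    (E1 : 4*(p0^2+p1^2+p2^2+p3^2+p4^2)+28*(q0^2+q1^2+q2^2+q3^2+q4^2)+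
      s*(R0^2+R1^2+R2^2+R3^2+R4^2)+7*s*(U0^2+U1^2+U2^2+U3^2+U4^2) = 48+12*s)
    (E2 : 4*(p0*q0+p1*q1+p2*q2+p3*q3+p4*q4)+s*(R0*U0+R1*U1+R2*U2+R3*U3+R4*U4) = 4+s)
    (E3 : (p0*R0+7*(q0*U0))+(p1*R1+7*(q1*U1))+(p2*R2+7*(q2*U2))
      +(p3*R3+7*(q3*U3))+(p4*R4+7*(q4*U4)) = 2)
    (E4 : (p0*U0+q0*R0)+(p1*U1+q1*R1)+(p2*U2+q2*R2)
      +(p3*U3+q3*R3)+(p4*U4+q4*R4) = 0)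
    (r0 : 0 ≤ R0) (r1 : R0 ≤ R1) (r2 : R1 ≤ R2) (r3 : R2 ≤ R3) (r4 : R3 ≤ R4)
    (a0 : R0 % 2 = U0 % 2) (a1 : R1 % 2 = U1 % 2) (a2 : R2 % 2 = U2 % 2)
    (a3 : R3 % 2 = U3 % 2) (a4 : R4 % 2 = U4 % 2) : False := by
  have f0 := sq_mod_four _ _ a0
  have f1 := sq_mod_four _ _ a1
  have f2 := sq_mod_four _ _ a2
  have f3 := sq_mod_four _ _ a3
  have f4 := sq_mod_four _ _ a4
  have g0 := mul_mod_two _ _ a0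
  have g1 := mul_mod_two _ _ a1
  have g2 := mul_mod_two _ _ a2
  have g3 := mul_mod_two _ _ a3
  have g4 := mul_mod_two _ _ a4
  have AG := five_AG 1 7 5 (by norm_num) (by norm_num) p0 p1 p2 p3 p4 q0 q1 q2 q3 q4
  have zP : 0 ≤ p0^2+p1^2+p2^2+p3^2+p4^2 := by positivity
  have zQ : 0 ≤ q0^2+q1^2+q2^2+q3^2+q4^2 := by positivity
  have zR : 0 ≤ R0^2+R1^2+R2^2+R3^2+R4^2 := by positivity
  have zU : 0 ≤ U0^2+U1^2+U2^2+U3^2+U4^2 := by positivity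
  obtain ⟨SP, hSP⟩ : ∃ t, t = p0^2+p1^2+p2^2+p3^2+p4^2 := ⟨_, rfl⟩
  obtain ⟨SQ, hSQ⟩ : ∃ t, t = q0^2+q1^2+q2^2+q3^2+q4^2 := ⟨_, rfl⟩
  obtain ⟨SR, hSR⟩ : ∃ t, t = R0^2+R1^2+R2^2+R3^2+R4^2 := ⟨_, rfl⟩
  obtain ⟨SU, hSU⟩ : ∃ t, t = U0^2+U1^2+U2^2+U3^2+U4^2 := ⟨_, rfl⟩
  obtain ⟨PQ, hPQ⟩ : ∃ t, t = p0*q0+p1*q1+p2*q2+p3*q3+p4*q4 := ⟨_, rfl⟩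
  obtain ⟨RU, hRU⟩ : ∃ t, t = R0*U0+R1*U1+R2*U2+R3*U3+R4*U4 := ⟨_, rfl⟩
  rw [← hSP, ← hSQ, ← hSR, ← hSU] at E1
  rw [← hPQ, ← hRU] at E2
  rw [← hPQ, ← hSP, ← hSQ] at AG
  rw [← hSP] at zP
  rw [← hSQ] at zQ
  rw [← hSR] at zR
  rw [← hSU] at zU
  have hRUodd : RU % 2 = 1 := by
    obtain ⟨k, rfl⟩ : ∃ k, s = 4*k+2 := ⟨s/4, by omega⟩
    have : (4*k+2)*RU = 4*(k*RU)+2*RU := by ring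
    omega
  have m1 : SU % 2 = 1 := by omega
  have m2 : SR % 4 = SU % 4 := by omega
  have hB : SR + 7*SU ≤ 16 := by
    by_contra hh
    have : s*17 ≤ s*(SR+7*SU) := mul_le_mul_of_nonneg_left (by omega) (by omega)
    linarith
  have hU1 : SU = 1 := by omega
  have hR9 : SR = 1 ∨ SR = 5 ∨ SR = 9 := by omega
  clear f0 f1 f2 f3 f4 g0 g1 g2 g3 g4
  rcases hR9 with h | h | h
  · rw [h] at hSR
    obtain ⟨hR0, hR1, hR4⟩ := R_bound R0 R1 R2 R3 R4 r0 r1 r2 r3 r4 (by omega)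
    have hR4' : R4 = 1 := by
      by_contra h0
      have : R4 = 0 := by omega
      have : R3 = 0 := by omega
      have : R2 = 0 := by omega
      subst R0 R1 R2 R3 R4
      omega
    subst hR4'
    obtain ⟨rfl, rfl, rfl, rfl, -⟩ := five_zero R0 R1 R2 R3 0 (by omega)
    have o4 := odd_sq U4 (by omega)
    obtain ⟨rfl, rfl, rfl, rfl, -⟩ := five_zero U0 U1 U2 U3 0 (by omega)
    have : U4 = 1 ∨ U4 = -1 := sq_one_cases U4 (by omega)
    rcases this with rfl | rfl
    · omega
    · have : RU = -1 := by omega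
      subst h hU1 this
      omega
  · rw [h] at hSR
    rcases R_five R0 R1 R2 R3 R4 r0 r1 r2 r3 r4 (by omega) with ⟨rfl, rfl, rfl, rfl, rfl⟩ | ⟨rfl, rfl, rfl, rfl, rfl⟩
    · have o4 := odd_sq U3 (by omega)
      obtain ⟨rfl, rfl, rfl, rfl, -⟩ := five_zero U0 U1 U2 U4 0 (by omega)
      have : U3 = 1 ∨ U3 = -1 := sq_one_cases U3 (by omega)
      rcases this with rfl | rfl
      · have hRU1 : RU = 1 := by omega
        rw [h, hU1] at E1
        rw [hRU1] at E2
        exact fin2 p0 p1 p2 p3 p4 q0 q1 q2 q3 q4 (by linarith) (by linarith) (by linarith) (by linarith)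
      · have : RU = -1 := by omega
        subst h hU1 this
        omega
    · have := odd_sq U0 (by omega)
      have := odd_sq U1 (by omega)
      have := odd_sq U2 (by omega)
      have := odd_sq U3 (by omega)
      have := odd_sq U4 (by omega)
      omega
  · rw [h, hU1] at E1
    have : SQ < 1 := by omega
    obtain ⟨rfl, rfl, rfl, rfl, rfl⟩ := five_zero q0 q1 q2 q3 q4 (by omega)
    have hPQ0 : PQ = 0 := by rw [hPQ]; ring
    subst hPQ0
    have : s = 10 := by omega
    subst this
    omega

lemma sq_mod4 (P : ℤ) : P^2 % 4 = P % 2 := by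
  rcases Int.emod_two_eq_zero_or_one P with h | h
  · obtain ⟨p, rfl⟩ : ∃ p, P = 2*p := ⟨P/2, by omega⟩
    have : (2*p)^2 = 4*p^2 := by ring
    omega
  · obtain ⟨p, rfl⟩ : ∃ p, P = 2*p+1 := ⟨P/2, by omega⟩
    have : (2*p+1)^2 = 4*(p^2+p)+1 := by ring
    omega

lemma mul_mod4 (s R r c : ℤ) (hs : s % 4 = c) (hR : R % 4 = r) : (s*R) % 4 = (c*r) % 4 := by
  rw [Int.mul_emod, hs, hR]

lemma mul_mod2 (P Q : ℤ) : (P*Q) % 2 = ((P%2)*(Q%2)) % 2 := Int.mul_emod _ _ _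

lemma parity1 (s P Q R U : ℤ) (hs : s % 4 = 1) (h1 : (P^2+7*Q^2-s*R^2-7*s*U^2) % 4 = 0)
    (h2 : (P*Q-s*(R*U)) % 2 = 0) : P % 2 = R % 2 ∧ Q % 2 = U % 2 := by
  have e1 := sq_mod4 P
  have e2 := sq_mod4 Q
  have e3 := mul_mod4 s (R^2) _ _ hs (sq_mod4 R)
  have e4 := mul_mod4 s (U^2) _ _ hs (sq_mod4 U)
  have e5 := mul_mod2 P Q
  have e6 := mul_mod2 R U
  have e7 := mul_mod2 s (R*U)
  rw [mul_assoc] at h1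
  have es : s % 2 = 1 := by omega
  rw [es] at e7
  generalize P^2 = p at *
  generalize Q^2 = q at *
  generalize s*R^2 = r at *
  generalize s*U^2 = u at *
  generalize P*Q = pq at *
  generalize s*(R*U) = sru at *
  generalize R*U = ru at *
  rcases Int.emod_two_eq_zero_or_one P with a | a <;> rcases Int.emod_two_eq_zero_or_one Q with b | b <;>
  rcases Int.emod_two_eq_zero_or_one R with c | c <;> rcases Int.emod_two_eq_zero_or_one U with d | d <;>
  rw [a, b] at e5 <;> rw [c, d] at e6 <;> rw [a] at e1 <;> rw [b] at e2 <;> rw [c] at e3 <;>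
  rw [d] at e4 <;> omega

lemma parity3 (s P Q R U : ℤ) (hs : s % 4 = 3) (h1 : (P^2+7*Q^2-s*R^2-7*s*U^2) % 4 = 0)
    (h2 : (P*Q-s*(R*U)) % 2 = 0) : P % 2 = U % 2 ∧ Q % 2 = R % 2 := by
  have e1 := sq_mod4 P
  have e2 := sq_mod4 Q
  have e3 := mul_mod4 s (R^2) _ _ hs (sq_mod4 R)
  have e4 := mul_mod4 s (U^2) _ _ hs (sq_mod4 U)
  have e5 := mul_mod2 P Q
  have e6 := mul_mod2 R U
  have e7 := mul_mod2 s (R*U)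
  rw [mul_assoc] at h1
  have es : s % 2 = 1 := by omega
  rw [es] at e7
  generalize P^2 = p at *
  generalize Q^2 = q at *
  generalize s*R^2 = r at *
  generalize s*U^2 = u at *
  generalize P*Q = pq at *
  generalize s*(R*U) = sru at *
  generalize R*U = ru at *
  rcases Int.emod_two_eq_zero_or_one P with a | a <;> rcases Int.emod_two_eq_zero_or_one Q with b | b <;>
  rcases Int.emod_two_eq_zero_or_one R with c | c <;> rcases Int.emod_two_eq_zero_or_one U with d | d <;>
  rw [a, b] at e5 <;> rw [c, d] at e6 <;> rw [a] at e1 <;> rw [b] at e2 <;> rw [c] at e3 <;>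
  rw [d] at e4 <;> omega

lemma parity2 (s P Q R U : ℤ) (hs : s % 4 = 2) (h1 : (P^2+7*Q^2-s*R^2-7*s*U^2) % 4 = 0)
    (h2 : (P*Q-s*(R*U)) % 2 = 0) : P % 2 = 0 ∧ Q % 2 = 0 ∧ R % 2 = U % 2 := by
  have e1 := sq_mod4 P
  have e2 := sq_mod4 Q
  have e3 := mul_mod4 s (R^2) _ _ hs (sq_mod4 R)
  have e4 := mul_mod4 s (U^2) _ _ hs (sq_mod4 U)
  have e5 := mul_mod2 P Q
  have e7 := mul_mod2 s (R*U)
  rw [mul_assoc] at h1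
  have es : s % 2 = 0 := by omega
  rw [es, zero_mul] at e7
  generalize P^2 = p at *
  generalize Q^2 = q at *
  generalize s*R^2 = r at *
  generalize s*U^2 = u at *
  generalize P*Q = pq at *
  generalize s*(R*U) = sru at *
  rcases Int.emod_two_eq_zero_or_one P with a | a <;> rcases Int.emod_two_eq_zero_or_one Q with b | b <;>
  rcases Int.emod_two_eq_zero_or_one R with c | c <;> rcases Int.emod_two_eq_zero_or_one U with d | d <;>
  rw [a, b] at e5 <;> rw [a] at e1 <;> rw [b] at e2 <;> rw [c] at e3 <;>
  rw [d] at e4 <;> omega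

/-- Coordinates of a sum of five squares, sorted by the nonnegative coefficient of `√s`. -/
lemma extract (s : ℕ) (hsf : Squarefree s) (hs7 : 7 < s) (h7s : Squarefree (7*s))
    (x : Fin 5 → ℝ) (hx : ∀ i, x i ∈ ringOfInt 7 (s:ℝ)) :
    ∃ P Q R U : Fin 5 → ℤ,
      (∀ i, (P i^2+7*Q i^2-s*R i^2-7*s*U i^2) % 4 = 0 ∧ (P i*Q i-s*(R i*U i)) % 2 = 0) ∧
      (∀ i, 0 ≤ R i) ∧ Monotone R ∧
      ∀ A B C D : ℤ, 4 * ∑ i, x i^2 = (A:ℝ)+(2*B:ℤ)*√7+(2*C:ℤ)*√s+(2*D:ℤ)*(√7*√s) →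
        ∑ i, (P i^2+7*Q i^2+s*R i^2+7*s*U i^2) = A ∧
        ∑ i, (P i*Q i+s*(R i*U i)) = B ∧
        ∑ i, (P i*R i+7*(Q i*U i)) = C ∧
        ∑ i, (P i*U i+Q i*R i) = D := by
  have r7 : (√(7:ℝ))^2 = 7 := Real.sq_sqrt (by positivity)
  have rs : (√(s:ℝ))^2 = s := Real.sq_sqrt (by positivity)
  have key : ∀ i, ∃ P Q R U : ℤ, (2*x i)^2 = (P+Q*√7+R*√s+U*(√7*√s))^2 ∧
      ((P^2+7*Q^2-s*R^2-7*s*U^2) % 4 = 0 ∧ (P*Q-s*(R*U)) % 2 = 0) ∧ 0 ≤ R := by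
    intro i
    obtain ⟨P, Q, R, U, h1, h2, h3⟩ := coords s hsf hs7 h7s (x i) (hx i).1 (hx i).2
    rcases le_total 0 R with hR | hR
    · exact ⟨P, Q, R, U, by rw [h1], ⟨h2, h3⟩, hR⟩
    · refine ⟨-P, -Q, -R, -U, by rw [h1]; push_cast; ring, ⟨?_, ?_⟩, by omega⟩
      · rw [← h2]; ring_nf
      · rw [← h3]; ring_nf
  choose P Q R U h1 h2 h3 using key
  refine ⟨P ∘ Tuple.sort R, Q ∘ Tuple.sort R, R ∘ Tuple.sort R, U ∘ Tuple.sort R,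
    fun i => h2 _, fun i => h3 _, Tuple.monotone_sort R, ?_⟩
  intro A B C D h
  simp only [Function.comp_apply]
  rw [Equiv.sum_comp (Tuple.sort R) (fun i => P i^2+7*Q i^2+s*R i^2+7*s*U i^2),
    Equiv.sum_comp (Tuple.sort R) (fun i => P i*Q i+s*(R i*U i)),
    Equiv.sum_comp (Tuple.sort R) (fun i => P i*R i+7*(Q i*U i)),
    Equiv.sum_comp (Tuple.sort R) (fun i => P i*U i+Q i*R i)]
  have e : 4 * ∑ i, x i^2 = ((∑ i, (P i^2+7*Q i^2+s*R i^2+7*s*U i^2) : ℤ):ℝ)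
      + ((2*∑ i, (P i*Q i+s*(R i*U i)) : ℤ):ℝ)*√7
      + ((2*∑ i, (P i*R i+7*(Q i*U i)) : ℤ):ℝ)*√s
      + ((2*∑ i, (P i*U i+Q i*R i) : ℤ):ℝ)*(√7*√s) := by
    push_cast
    simp only [Finset.mul_sum, Finset.sum_mul, ← Finset.sum_add_distrib]
    apply Finset.sum_congr rfl
    intro i _
    have := h1 i
    generalize √(7:ℝ) = a at *
    generalize √(s:ℝ) = b at *
    linear_combination this + ((Q i:ℝ)^2+2*(Q i)*(U i)*b+(U i)^2*b^2)*r7 + ((R i:ℝ)^2+2*(R i)*(U i)*a+7*(U i)^2)*rs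
  generalize (∑ i, (P i^2+7*Q i^2+s*R i^2+7*s*U i^2)) = A' at *
  generalize (∑ i, (P i*Q i+s*(R i*U i))) = B' at *
  generalize (∑ i, (P i*R i+7*(Q i*U i))) = C' at *
  generalize (∑ i, (P i*U i+Q i*R i)) = D' at *
  rw [e] at h
  obtain ⟨k1, k2, k3, k4⟩ := lin_indep s hsf hs7 h7s (A'-A) (2*B'-2*B) (2*C'-2*C) (2*D'-2*D) (by
    push_cast at h ⊢; linear_combination h)
  refine ⟨?_, ?_, ?_, ?_⟩
  · have : (A':ℚ) = A := by linarith
    exact_mod_cast this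
  · have : (B':ℚ) = B := by linarith
    exact_mod_cast this
  · have : (C':ℚ) = C := by linarith
    exact_mod_cast this
  · have : (D':ℚ) = D := by linarith
    exact_mod_cast this

lemma roi_add {s : ℝ} {x y : ℝ} (hx : x ∈ ringOfInt 7 s) (hy : y ∈ ringOfInt 7 s) :
    x + y ∈ ringOfInt 7 s := ⟨add_mem hx.1 hy.1, hx.2.add hy.2⟩

lemma roi_mul {s : ℝ} {x y : ℝ} (hx : x ∈ ringOfInt 7 s) (hy : y ∈ ringOfInt 7 s) :
    x * y ∈ ringOfInt 7 s := ⟨mul_mem hx.1 hy.1, hx.2.mul hy.2⟩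

lemma roi_int {s : ℝ} (n : ℤ) : (n:ℝ) ∈ ringOfInt 7 s :=
  ⟨intCast_mem _ n, by simpa using isIntegral_algebraMap (R := ℤ) (A := ℝ) (x := n)⟩

lemma roi_seven {s : ℝ} : √(7:ℝ) ∈ ringOfInt 7 s := by
  refine ⟨IntermediateField.subset_adjoin _ _ (by simp), ?_⟩
  apply IsIntegral.of_pow (n := 2) (by norm_num)
  rw [Real.sq_sqrt (by norm_num)]
  exact_mod_cast (roi_int (s := s) 7).2

lemma roi_sqrt (s : ℕ) : √(s:ℝ) ∈ ringOfInt 7 (s:ℝ) := by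
  refine ⟨IntermediateField.subset_adjoin _ _ (by simp), ?_⟩
  apply IsIntegral.of_pow (n := 2) (by norm_num)
  rw [Real.sq_sqrt (by positivity)]
  exact_mod_cast (roi_int (s := s) (s:ℤ)).2

/-- closure of the ring under roots of monic quadratics -/
lemma roi_quad {s : ℝ} (y b c : ℝ) (hb : b ∈ ringOfInt 7 s) (hc : c ∈ ringOfInt 7 s)
    (h : y * (y + b) = c) (z : ℝ) (hz : z ∈ ringOfInt 7 s) (hy : 2 * y = z) :
    y ∈ ringOfInt 7 s := by
  constructor
  · have : y = z / ((2:ℤ):ℝ) := by push_cast; linarith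
    rw [this]
    exact div_mem hz.1 (intCast_mem _ 2)
  · let b' : integralClosure ℤ ℝ := ⟨b, hb.2⟩
    let c' : integralClosure ℤ ℝ := ⟨c, hc.2⟩
    apply isIntegral_trans (A := integralClosure ℤ ℝ)
    refine ⟨Polynomial.X^2 + Polynomial.C b' * Polynomial.X - Polynomial.C c', ?_, ?_⟩
    · monicity!
    · simp only [Polynomial.eval₂_sub, Polynomial.eval₂_add, Polynomial.eval₂_mul, Polynomial.eval₂_pow,
        Polynomial.eval₂_X, Polynomial.eval₂_C]
      change y^2 + b*y - c = 0
      linarith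

lemma pyth_of (S : Set ℝ) (h0 : (0:ℝ) ∈ S) (α : ℝ) (hα : SumOfSquaresLen S 6 α)
    (h5 : ∀ x : Fin 5 → ℝ, (∀ i, x i ∈ S) → α ≠ ∑ i, x i^2) : 6 ≤ pythagorasNumber S := by
  refine le_trans ?_ (le_sSup ⟨α, ⟨6, hα⟩, rfl⟩)
  apply le_sInf
  rintro _ ⟨k, rfl, x, hx, hs⟩
  by_contra hk
  have hk : k ≤ 5 := by
    have : k < 6 := by
      rw [not_le] at hk
      exact_mod_cast hk
    omega
  refine h5 (fun i => if h : i.1 < k then x ⟨i, h⟩ else 0) ?_ ?_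
  · intro i
    by_cases h : i.1 < k
    · simp only [h, dite_true]; exact hx _
    · simp only [h, dite_false]; exact h0
  · rw [hs]
    clear hs hx
    interval_cases k <;> simp [Fin.sum_univ_succ]

lemma six_sum (S : Set ℝ) (a b c d e f : ℝ) (ha : a ∈ S) (hb : b ∈ S) (hc : c ∈ S) (hd : d ∈ S)
    (he : e ∈ S) (hf : f ∈ S) : SumOfSquaresLen S 6 (a^2+b^2+c^2+d^2+e^2+f^2) := by
  refine ⟨![a,b,c,d,e,f], ?_, ?_⟩
  · intro i; fin_cases i <;> simpa
  · simp [Fin.sum_univ_succ]; ring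

theorem m7_pythagoras_ge_six (s : ℕ) (hsf : Squarefree s) (hs7 : 7 < s)
    (hcop : Nat.Coprime s 7) :
    6 ≤ pythagorasNumber (ringOfInt 7 (s : ℝ)) := by
  have h7s : Squarefree (7*s) :=
    (Nat.squarefree_mul hcop.symm).2 ⟨(by norm_num : Nat.Prime 7).squarefree, hsf⟩
  have r7 : (√(7:ℝ))^2 = 7 := Real.sq_sqrt (by positivity)
  have rs : (√(s:ℝ))^2 = s := Real.sq_sqrt (by positivity)
  have s4 : s % 4 ≠ 0 := by
    intro h
    have : 2*2 ∣ s := by omega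
    have := hsf 2 this
    simp at this
  have s9 : s ≠ 9 := by
    rintro rfl
    have := hsf 3 (by norm_num)
    simp at this
  have m0 : (0:ℝ) ∈ ringOfInt 7 (s:ℝ) := by simpa using roi_int (s := (s:ℝ)) 0
  have m1 : (1:ℝ) ∈ ringOfInt 7 (s:ℝ) := by simpa using roi_int (s := (s:ℝ)) 1
  have mm1 : (-1:ℝ) ∈ ringOfInt 7 (s:ℝ) := by simpa using roi_int (s := (s:ℝ)) (-1)
  have m2 : (2:ℝ) ∈ ringOfInt 7 (s:ℝ) := by simpa using roi_int (s := (s:ℝ)) 2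
  have m7 : √(7:ℝ) ∈ ringOfInt 7 (s:ℝ) := roi_seven
  have ms : √(s:ℝ) ∈ ringOfInt 7 (s:ℝ) := roi_sqrt s
  have hcase : s % 4 = 1 ∨ s % 4 = 2 ∨ s % 4 = 3 := by omega
  rcases hcase with h4 | h4 | h4
  · -- the case s ≡ 1 mod 4
    have mw : (1+√(s:ℝ))/2 ∈ ringOfInt 7 (s:ℝ) := by
      obtain ⟨k, hk⟩ : ∃ k : ℕ, s = 4*k+1 := ⟨s/4, by omega⟩
      have hkr : (s:ℝ) = 4*k+1 := by exact_mod_cast hk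
      refine roi_quad _ (-1) ((k:ℤ):ℝ) mm1 (roi_int _) ?_ (1+√(s:ℝ)) (roi_add m1 ms) (by ring)
      push_cast
      linear_combination rs/4 + hkr/4
    apply pyth_of _ m0 _ (six_sum _ 1 1 1 (1+√7) ((1+√(s:ℝ))/2) (1+(1+√(s:ℝ))/2) m1 m1 m1
      (roi_add m1 m7) mw (roi_add m1 mw))
    intro x hx h
    obtain ⟨P, Q, R, U, par, pos, mon, eqs⟩ := extract s hsf hs7 h7s x hx
    obtain ⟨E1, E2, E3, E4⟩ := eqs (54+2*s) 4 4 0 (by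
      rw [← h]; push_cast
      linear_combination 4*r7+2*rs)
    rw [Fin.sum_univ_five] at E1 E2 E3 E4
    have pp := fun i => parity1 s _ _ _ _ (by omega) (par i).1 (par i).2
    exact core1 s (by omega) _ _ _ _ _ _ _ _ _ _ _ _ _ _ _ _ _ _ _ _ E1 E2 E3 E4 (pos 0)
      (mon (by decide)) (mon (by decide)) (mon (by decide)) (mon (by decide))
      (pp 0) (pp 1) (pp 2) (pp 3) (pp 4)
  · -- the case s ≡ 2 mod 4
    have mw : √(s:ℝ)*(1+√7)/2 ∈ ringOfInt 7 (s:ℝ) := by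
      obtain ⟨k, hk⟩ : ∃ k : ℕ, s = 2*k := ⟨s/2, by omega⟩
      have hkr : (s:ℝ) = 2*k := by exact_mod_cast hk
      refine roi_quad _ 0 (((k:ℤ):ℝ)*(2+2+√7)) m0
        (roi_mul (roi_int _) (roi_add (roi_add m2 m2) m7)) ?_ (√(s:ℝ)*(1+√7))
        (roi_mul ms (roi_add m1 m7)) (by ring)
      push_cast
      linear_combination (1+√7)^2/4*rs + (1+√7)^2/4*hkr + k/2*r7
    apply pyth_of _ m0 _ (six_sum _ 1 1 1 (1+√7) (√(s:ℝ)*(1+√7)/2) (1+√(s:ℝ)) m1 m1 m1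
      (roi_add m1 m7) mw (roi_add m1 ms))
    intro x hx h
    obtain ⟨P, Q, R, U, par, pos, mon, eqs⟩ := extract s hsf hs7 h7s x hx
    obtain ⟨E1, E2, E3, E4⟩ := eqs (48+12*s) (4+s) 4 0 (by
      rw [← h]; push_cast
      linear_combination (4+s)*r7+(4+(1+√7)^2)*rs)
    rw [Fin.sum_univ_five] at E1 E2 E3 E4
    have pp := fun i => parity2 s _ _ _ _ (by omega) (par i).1 (par i).2
    have hP : ∀ i, ∃ p, P i = 2*p := fun i => ⟨P i/2, by have := pp i; omega⟩
    have hQ : ∀ i, ∃ p, Q i = 2*p := fun i => ⟨Q i/2, by have := pp i; omega⟩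
    choose p hp using hP
    choose q hq using hQ
    simp only [hp, hq] at E1 E2 E3 E4
    refine core2 s (by omega) (by omega) (p 0) (p 1) (p 2) (p 3) (p 4) (q 0) (q 1) (q 2) (q 3) (q 4)
      (R 0) (R 1) (R 2) (R 3) (R 4) (U 0) (U 1) (U 2) (U 3) (U 4)
      (by linear_combination E1) (by linear_combination E2) (by linarith) (by linarith) (pos 0)
      (mon (by decide)) (mon (by decide)) (mon (by decide)) (mon (by decide))
      (pp 0).2.2 (pp 1).2.2 (pp 2).2.2 (pp 3).2.2 (pp 4).2.2
  · -- the case s ≡ 3 mod 4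
    have mv : (1+√7*√(s:ℝ))/2 ∈ ringOfInt 7 (s:ℝ) := by
      obtain ⟨k, hk⟩ : ∃ k : ℕ, 7*s = 4*k+1 := ⟨7*s/4, by omega⟩
      have hkr : 7*(s:ℝ) = 4*k+1 := by exact_mod_cast hk
      refine roi_quad _ (-1) ((k:ℤ):ℝ) mm1 (roi_int _) ?_ (1+√7*√(s:ℝ))
        (roi_add m1 (roi_mul m7 ms)) (by ring)
      push_cast
      linear_combination 7*rs/4 + (√(s:ℝ))^2*r7/4 + hkr/4
    have mw : (√7+√(s:ℝ))/2 ∈ ringOfInt 7 (s:ℝ) := by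
      obtain ⟨k, hk⟩ : ∃ k : ℕ, 7+s = 4*k+2 := ⟨(7+s)/4, by omega⟩
      have hkr : 7+(s:ℝ) = 4*k+2 := by exact_mod_cast hk
      refine roi_quad _ 0 (((k:ℤ):ℝ)+(1+√7*√(s:ℝ))/2) m0 (roi_add (roi_int _) mv) ?_
        (√7+√(s:ℝ)) (roi_add m7 ms) (by ring)
      push_cast
      linear_combination r7/4+rs/4+hkr/4
    by_cases h11 : s = 11
    · subst h11
      apply pyth_of _ m0 _ (six_sum _ 1 1 1 (2+√7) ((√7+√((11:ℕ):ℝ))/2) (1+(√7+√((11:ℕ):ℝ))/2)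
        m1 m1 m1 (roi_add m2 m7) mw (roi_add m1 mw))
      intro x hx h
      obtain ⟨P, Q, R, U, par, pos, mon, eqs⟩ := extract 11 hsf hs7 h7s x hx
      obtain ⟨E1, E2, E3, E4⟩ := eqs 96 10 2 2 (by
        rw [← h]; push_cast at rs ⊢
        linear_combination 6*r7+2*rs)
      rw [Fin.sum_univ_five] at E1 E2 E3 E4
      have pp := fun i => parity3 (11:ℕ) _ _ _ _ (by norm_num) (par i).1 (par i).2
      push_cast at E1 E2 E3 E4
      exact core11 _ _ _ _ _ _ _ _ _ _ _ _ _ _ _ _ _ _ _ _ E1 E2 E3 E4 (pos 0)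
        (mon (by decide)) (mon (by decide)) (mon (by decide)) (mon (by decide))
        (pp 0) (pp 1) (pp 2) (pp 3) (pp 4)
    · apply pyth_of _ m0 _ (six_sum _ 1 1 1 (1+√7) ((√7+√(s:ℝ))/2) (1+(√7+√(s:ℝ))/2) m1 m1 m1
        (roi_add m1 m7) mw (roi_add m1 mw))
      intro x hx h
      obtain ⟨P, Q, R, U, par, pos, mon, eqs⟩ := extract s hsf hs7 h7s x hx
      obtain ⟨E1, E2, E3, E4⟩ := eqs (62+2*s) 6 2 2 (by
        rw [← h]; push_cast
        linear_combination 6*r7+2*rs)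
      rw [Fin.sum_univ_five] at E1 E2 E3 E4
      have pp := fun i => parity3 s _ _ _ _ (by omega) (par i).1 (par i).2
      exact core3 s (by omega) _ _ _ _ _ _ _ _ _ _ _ _ _ _ _ _ _ _ _ _ E1 E2 E3 E4 (pos 0)
        (mon (by decide)) (mon (by decide)) (mon (by decide)) (mon (by decide))
        (pp 0) (pp 1) (pp 2) (pp 3) (pp 4)
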